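/- arXiv:2306.09571 — 3 statements merged into one kernel-verified Lean document; each statement's English description precedes it below -/
import Mathlib

section
/- Let d ≥ 1, p ∈ ℕ, let Ω ⊆ ℝ^d × ℝ be open, (z, s) ∈ Ω, and let ψ : ℝ^d × ℝ → ℂ be infinitely differentiable on Ω with i ∂_t ψ + (1/2) Δ_x ψ = 0 on Ω. Define the extended Taylor polynomial of degree 2p centered at (z, s) by Ẽ(x, t) := Σ_{(j_x, j_t) ∈ ℕ^d × ℕ : 2 j_t + |j_x| ≤ 2p} (1/(j_x! j_t!)) D^{(j_x, j_t)} ψ(z, s) (x − z)^{j_x} (t − s)^{j_t}. Then Ẽ is a polynomial in (x, t) of total degree at most 2p and satisfies i ∂_t Ẽ + (1/2) Δ_x Ẽ = 0 identically on ℝ^d × ℝ. -/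
noncomputable section

/-- Spatial partial derivative `∂/∂x_ℓ` of a function on `ℝ^d × ℝ`. -/
def pS (d : ℕ) (ℓ : Fin d) (f : (Fin d → ℝ) × ℝ → ℂ) : (Fin d → ℝ) × ℝ → ℂ :=
  fun y => fderiv ℝ f y (Pi.single ℓ 1, 0)

/-- Time partial derivative `∂/∂t` of a function on `ℝ^d × ℝ`. -/
def pT (d : ℕ) (f : (Fin d → ℝ) × ℝ → ℂ) : (Fin d → ℝ) × ℝ → ℂ :=
  fun y => fderiv ℝ f y (0, 1)

/-- Multi-index partial derivative `D^{(j_x, j_t)}`. -/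
def Dm (d : ℕ) (jx : Fin d → ℕ) (jt : ℕ) (f : (Fin d → ℝ) × ℝ → ℂ) : (Fin d → ℝ) × ℝ → ℂ :=
  (pT d)^[jt] ((List.finRange d).foldr (fun ℓ g => (pS d ℓ)^[jx ℓ] ∘ g) id f)

/-- The extended Taylor polynomial of degree `2p` of `ψ` centered at `(z, s)`:
`Ẽ(x,t) = Σ_{2 j_t + |j_x| ≤ 2p} (1/(j_x! j_t!)) D^{(j_x,j_t)} ψ(z,s) (x−z)^{j_x} (t−s)^{j_t}`. -/
def extTaylor (d p : ℕ) (ψ : (Fin d → ℝ) × ℝ → ℂ) (z : Fin d → ℝ) (s : ℝ) :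
    (Fin d → ℝ) × ℝ → ℂ := fun y =>
  ∑ jt ∈ Finset.range (p + 1),
    ∑ jx ∈ Fintype.piFinset (fun _ : Fin d => Finset.range (2 * p + 1)),
      if 2 * jt + ∑ ℓ, jx ℓ ≤ 2 * p then
        (((∏ ℓ, (jx ℓ).factorial) * jt.factorial : ℕ) : ℂ)⁻¹ * Dm d jx jt ψ (z, s) *
          (∏ ℓ, ((y.1 ℓ - z ℓ : ℝ) : ℂ) ^ jx ℓ) * ((y.2 - s : ℝ) : ℂ) ^ jt
      else 0

section DirectionalDerivatives

variable {E : Type*} [NormedAddCommGroup E] [NormedSpace ℝ E]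

/-- The derivative of `f` in the direction `v`, as a function of the base point. -/
def dirDeriv (v : E) (f : E → ℂ) : E → ℂ := fun y => fderiv ℝ f y v

/-- The iterated derivative of `f` along a list of directions. -/
def iterDirDeriv (L : List E) (f : E → ℂ) : E → ℂ := L.foldr dirDeriv f

theorem iterate_dirDeriv (v : E) (n : ℕ) (f : E → ℂ) :
    (dirDeriv v)^[n] f = iterDirDeriv (List.replicate n v) f := by
  induction n with
  | zero => rfl
  | succ n ih => rw [Function.iterate_succ_apply', ih]; rfl

theorem iterDirDeriv_append (L L' : List E) (f : E → ℂ) :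
    iterDirDeriv (L ++ L') f = iterDirDeriv L (iterDirDeriv L' f) :=
  List.foldr_append

variable {Ω : Set E}

theorem ContDiffOn.dirDeriv (hΩ : IsOpen Ω) {f : E → ℂ} (hf : ContDiffOn ℝ (⊤ : ℕ∞) f Ω) (v : E) :
    ContDiffOn ℝ (⊤ : ℕ∞) (dirDeriv v f) Ω :=
  (hf.fderiv_of_isOpen hΩ (by simp)).clm_apply contDiffOn_const

theorem ContDiffOn.iterDirDeriv (hΩ : IsOpen Ω) {f : E → ℂ} (hf : ContDiffOn ℝ (⊤ : ℕ∞) f Ω) (L : List E) :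
    ContDiffOn ℝ (⊤ : ℕ∞) (iterDirDeriv L f) Ω := by
  induction L with
  | nil => exact hf
  | cons v L ih => exact ContDiffOn.dirDeriv hΩ ih v

theorem Set.EqOn.dirDeriv (hΩ : IsOpen Ω) {f g : E → ℂ} (h : Set.EqOn f g Ω) (v : E) :
    Set.EqOn (dirDeriv v f) (dirDeriv v g) Ω := fun y hy => by
  have : f =ᶠ[nhds y] g := h.eventuallyEq_of_mem (hΩ.mem_nhds hy)
  simp only [_root_.dirDeriv, this.fderiv_eq]

theorem Set.EqOn.iterDirDeriv (hΩ : IsOpen Ω) {f g : E → ℂ} (h : Set.EqOn f g Ω) (L : List E) :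
    Set.EqOn (iterDirDeriv L f) (iterDirDeriv L g) Ω := by
  induction L with
  | nil => exact h
  | cons v L ih => exact Set.EqOn.dirDeriv hΩ ih v

theorem dirDeriv_comm (hΩ : IsOpen Ω) {f : E → ℂ} (hf : ContDiffOn ℝ (⊤ : ℕ∞) f Ω) (v w : E) :
    Set.EqOn (dirDeriv v (dirDeriv w f)) (dirDeriv w (dirDeriv v f)) Ω := fun y hy => by
  have hfy := hf.contDiffAt (hΩ.mem_nhds hy)
  have hd : DifferentiableAt ℝ (fderiv ℝ f) y :=
    ((hf.fderiv_of_isOpen hΩ (m := (⊤ : ℕ∞)) (by simp)).contDiffAt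
      (hΩ.mem_nhds hy)).differentiableAt (by simp)
  have key : ∀ a b : E, dirDeriv a (dirDeriv b f) y = fderiv ℝ (fderiv ℝ f) y a b := by
    intro a b
    have := fderiv_clm_apply hd (differentiableAt_const b)
    change fderiv ℝ (fun y => fderiv ℝ f y b) y a = _
    rw [this]
    simp
  have hsmooth : minSmoothness ℝ 2 ≤ ((⊤ : ℕ∞) : WithTop ℕ∞) := by
    rw [minSmoothness_of_isRCLikeNormedField]
    exact WithTop.coe_le_coe.2 (le_top : (2 : ℕ∞) ≤ ⊤)
  rw [key, key]
  exact (hfy.isSymmSndFDerivAt hsmooth).eq v w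

theorem iterDirDeriv_perm (hΩ : IsOpen Ω) {f : E → ℂ} (hf : ContDiffOn ℝ (⊤ : ℕ∞) f Ω) {L L' : List E}
    (h : L.Perm L') : Set.EqOn (iterDirDeriv L f) (iterDirDeriv L' f) Ω := by
  induction h with
  | nil => exact fun _ _ => rfl
  | cons v _ ih => exact Set.EqOn.dirDeriv hΩ ih v
  | swap v w L => exact dirDeriv_comm hΩ (hf.iterDirDeriv hΩ L) w v
  | trans _ _ ih₁ ih₂ => exact ih₁.trans ih₂

theorem iterDirDeriv_sum (hΩ : IsOpen Ω) {κ : Type*} (s : Finset κ) (c : κ → ℂ) (f : κ → E → ℂ)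
    (hf : ∀ k ∈ s, ContDiffOn ℝ (⊤ : ℕ∞) (f k) Ω) (L : List E) :
    Set.EqOn (iterDirDeriv L fun y => ∑ k ∈ s, c k * f k y)
      (fun y => ∑ k ∈ s, c k * iterDirDeriv L (f k) y) Ω := by
  induction L with
  | nil => exact fun _ _ => rfl
  | cons v L ih =>
    refine (Set.EqOn.dirDeriv hΩ ih v).trans fun y hy => ?_
    have hd : ∀ k ∈ s, DifferentiableAt ℝ (iterDirDeriv L (f k)) y := fun k hk =>
      (((hf k hk).iterDirDeriv hΩ L).contDiffAt (hΩ.mem_nhds hy)).differentiableAt (by simp)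
    simp only [dirDeriv]
    rw [fderiv_fun_sum fun k hk => (hd k hk).const_mul (c k), sum_apply]
    refine Finset.sum_congr rfl fun k hk => ?_
    rw [fderiv_const_mul (hd k hk)]
    rfl

end DirectionalDerivatives

section WeightedTaylor

/-- The divided power `x ^ n / n!`. -/
def divPow (n : ℕ) (x : ℝ) : ℂ := (x : ℂ) ^ n / (n.factorial : ℂ)

theorem hasDerivAt_divPow_succ (n : ℕ) (x : ℝ) :
    HasDerivAt (divPow (n + 1)) (divPow n x) x := by
  have h := ((Complex.ofRealCLM.hasDerivAt (x := x)).pow (n + 1)).div_const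
    ((n + 1).factorial : ℂ)
  refine h.congr_deriv ?_
  have h1 : ((n : ℂ) + 1) ≠ 0 := by exact_mod_cast n.succ_ne_zero
  have h2 : (n.factorial : ℂ) ≠ 0 := by exact_mod_cast n.factorial_ne_zero
  simp only [divPow, Nat.factorial_succ, Complex.ofRealCLM_apply]
  push_cast
  field_simp

theorem differentiable_divPow (n : ℕ) : Differentiable ℝ (divPow n) :=
  ((Complex.ofRealCLM.differentiable).pow n).div_const _

variable {E : Type*} [NormedAddCommGroup E] [NormedSpace ℝ E] {ι : Type*} [Fintype ι]

/-- The monomial `∏ i, κ i (y - c) ^ j i / j i !` in the coordinates `κ` centered at `c`. -/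
def divMonomial (κ : ι → E →L[ℝ] ℝ) (c : E) (j : ι → ℕ) (y : E) : ℂ :=
  ∏ i, divPow (j i) (κ i (y - c))

theorem differentiable_divMonomial (κ : ι → E →L[ℝ] ℝ) (c : E) (j : ι → ℕ) :
    Differentiable ℝ (divMonomial κ c j) := by
  classical
  have h : ∀ i, Differentiable ℝ fun y => divPow (j i) (κ i (y - c)) := fun i =>
    (differentiable_divPow (j i)).comp ((κ i).differentiable.comp (differentiable_id.sub_const c))
  exact fun y =>
    (HasFDerivAt.finsetProd fun i (_ : i ∈ Finset.univ) =>
      (h i y).hasFDerivAt).differentiableAt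

variable [DecidableEq ι]

/-- The multi-indices `j` of weighted degree `∑ i, wt i * j i` less than `n`. -/
def weightedIndices (wt : ι → ℕ) (n : ℕ) : Finset (ι → ℕ) :=
  (Fintype.piFinset fun _ => Finset.range n).filter fun j => ∑ i, wt i * j i < n

theorem mem_weightedIndices {wt : ι → ℕ} (hwt : ∀ i, 1 ≤ wt i) {n : ℕ} {j : ι → ℕ} :
    j ∈ weightedIndices wt n ↔ ∑ i, wt i * j i < n := by
  simp only [weightedIndices, Finset.mem_filter, Fintype.mem_piFinset, Finset.mem_range,
    and_iff_right_iff_imp]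
  intro h i
  calc j i ≤ wt i * j i := Nat.le_mul_of_pos_left _ (hwt i)
    _ ≤ ∑ i, wt i * j i :=
      Finset.single_le_sum (f := fun i => wt i * j i) (fun _ _ => Nat.zero_le _)
        (Finset.mem_univ i)
    _ < n := h

/-- The weighted polynomial with coefficients `a` in the divided monomials. -/
def weightedPoly (wt : ι → ℕ) (κ : ι → E →L[ℝ] ℝ) (c : E) (a : (ι → ℕ) → ℂ) (n : ℕ) (y : E) : ℂ :=
  ∑ j ∈ weightedIndices wt n, a j * divMonomial κ c j y

variable {κ : ι → E →L[ℝ] ℝ} {e : ι → E}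

theorem divMonomial_line
    (hκ : ∀ i k, κ i (e k) = if i = k then 1 else 0) (c : E) (j : ι → ℕ) (k : ι) (y : E) (h : ℝ) :
    divMonomial κ c j (y + h • e k) = divPow (j k) (κ k (y - c) + h) *
      ∏ i ∈ Finset.univ.erase k, divPow (j i) (κ i (y - c)) := by
  rw [divMonomial, ← Finset.mul_prod_erase _ _ (Finset.mem_univ k)]
  congr 1
  · simp only [map_sub, map_add, map_smul, hκ, if_true, smul_eq_mul, mul_one]
    congr 1
    ring
  · refine Finset.prod_congr rfl fun i hi => ?_
    simp [hκ, Finset.ne_of_mem_erase hi]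

theorem dirDeriv_divMonomial_of_eq_zero
    (hκ : ∀ i k, κ i (e k) = if i = k then 1 else 0) (c : E) {j : ι → ℕ} {k : ι} (hj : j k = 0) (y : E) :
    dirDeriv (e k) (divMonomial κ c j) y = 0 := by
  rw [dirDeriv, ← (differentiable_divMonomial κ c j y).lineDeriv_eq_fderiv, lineDeriv]
  simp [divMonomial_line hκ, hj, divPow]

theorem dirDeriv_divMonomial_add_single
    (hκ : ∀ i k, κ i (e k) = if i = k then 1 else 0) (c : E) (j : ι → ℕ) (k : ι) (y : E) :
    dirDeriv (e k) (divMonomial κ c (j + Pi.single k 1)) y = divMonomial κ c j y := by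
  rw [dirDeriv, ← (differentiable_divMonomial κ c _ y).lineDeriv_eq_fderiv, lineDeriv]
  have h := divMonomial_line hκ c j k y 0
  rw [zero_smul, add_zero, add_zero] at h
  rw [h]
  refine HasDerivAt.deriv ?_
  have h1 : HasDerivAt (fun t => divPow (j k + 1) (κ k (y - c) + t))
      (divPow (j k) (κ k (y - c))) 0 := by
    refine HasDerivAt.comp_const_add (κ k (y - c)) 0 ?_
    simpa using hasDerivAt_divPow_succ (j k) (κ k (y - c))
  refine (h1.mul_const _).congr_of_eventuallyEq (Filter.Eventually.of_forall fun t => ?_)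
  dsimp only
  rw [divMonomial_line hκ]
  congr 1
  · simp
  · refine Finset.prod_congr rfl fun i hi => ?_
    simp [Finset.ne_of_mem_erase hi]

theorem dirDeriv_weightedPoly
    (hκ : ∀ i k, κ i (e k) = if i = k then 1 else 0) {wt : ι → ℕ} (hwt : ∀ i, 1 ≤ wt i) (c : E) (a : (ι → ℕ) → ℂ)
    (n : ℕ) (k : ι) :
    dirDeriv (e k) (weightedPoly wt κ c a n) =
      weightedPoly wt κ c (fun j => a (j + Pi.single k 1)) (n - wt k) := by
  funext y
  have hd : ∀ j, DifferentiableAt ℝ (divMonomial κ c j) y := fun j =>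
    differentiable_divMonomial κ c j y
  have hsum : dirDeriv (e k) (weightedPoly wt κ c a n) y =
      ∑ j ∈ weightedIndices wt n, a j * dirDeriv (e k) (divMonomial κ c j) y := by
    simp only [dirDeriv]
    unfold weightedPoly
    rw [fderiv_fun_sum fun j _ => (hd j).const_mul (a j), sum_apply]
    refine Finset.sum_congr rfl fun j _ => ?_
    rw [fderiv_const_mul (hd j)]
    rfl
  have hweight : ∀ j : ι → ℕ,
      ∑ i, wt i * (j + Pi.single k 1 : ι → ℕ) i = ∑ i, wt i * j i + wt k := fun j => by
    simp [mul_add, Finset.sum_add_distrib, Pi.single_apply]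
  rw [hsum, weightedPoly]
  symm
  refine Finset.sum_of_injOn (fun j => j + Pi.single k 1) (add_left_injective _).injOn ?_ ?_ ?_
  · intro j hj
    simp only [Finset.mem_coe, mem_weightedIndices hwt] at hj ⊢
    rw [hweight]
    omega
  · intro j hj hnot
    rw [dirDeriv_divMonomial_of_eq_zero hκ, mul_zero]
    by_contra hjk
    have hle : Pi.single k 1 ≤ j := by
      intro i
      rcases eq_or_ne i k with rfl | hi
      · simpa using Nat.one_le_iff_ne_zero.2 hjk
      · simp [hi]
    refine hnot ⟨j - Pi.single k 1, ?_, tsub_add_cancel_of_le hle⟩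
    rw [mem_weightedIndices hwt, ← tsub_add_cancel_of_le hle, hweight] at hj
    rw [Finset.mem_coe, mem_weightedIndices hwt]
    omega
  · intro j _
    rw [dirDeriv_divMonomial_add_single hκ]

end WeightedTaylor

section Schrodinger

/-- The time weight is `2` and each space weight is `1`. -/
def parabolicWeight (d : ℕ) : Option (Fin d) → ℕ := fun o => o.elim 2 fun _ => 1

/-- The standard basis of `ℝ^d × ℝ`, with `none` the time direction. -/
def spaceTimeBasis (d : ℕ) : Option (Fin d) → (Fin d → ℝ) × ℝ :=
  fun o => o.elim (0, 1) fun ℓ => (Pi.single ℓ 1, 0)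

/-- The coordinates of `ℝ^d × ℝ`, with `none` the time coordinate. -/
def spaceTimeCoord (d : ℕ) : Option (Fin d) → (Fin d → ℝ) × ℝ →L[ℝ] ℝ :=
  fun o => o.elim (ContinuousLinearMap.snd ℝ _ _) fun ℓ =>
    (ContinuousLinearMap.proj ℓ).comp (ContinuousLinearMap.fst ℝ _ _)

variable {d : ℕ}

theorem one_le_parabolicWeight (o : Option (Fin d)) : 1 ≤ parabolicWeight d o := by
  cases o <;> simp [parabolicWeight]

theorem spaceTimeCoord_basis (i k : Option (Fin d)) :
    spaceTimeCoord d i (spaceTimeBasis d k) = if i = k then 1 else 0 := by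
  cases i <;> cases k <;> simp [spaceTimeCoord, spaceTimeBasis, Pi.single_apply]

theorem sum_parabolicWeight (j : Option (Fin d) → ℕ) :
    ∑ o, parabolicWeight d o * j o = 2 * j none + ∑ ℓ, j (some ℓ) := by
  simp [Fintype.sum_option, parabolicWeight]

/-- The directions, with multiplicity, of the derivative `Dm` with multi-index `j`. -/
def directions (j : Option (Fin d) → ℕ) : List ((Fin d → ℝ) × ℝ) :=
  List.replicate (j none) (spaceTimeBasis d none) ++
    (List.finRange d).flatMap fun ℓ => List.replicate (j (some ℓ)) (spaceTimeBasis d (some ℓ))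

theorem coe_directions (j : Option (Fin d) → ℕ) :
    (directions j : Multiset ((Fin d → ℝ) × ℝ)) =
      ∑ o, Multiset.replicate (j o) (spaceTimeBasis d o) := by
  rw [Fintype.sum_option, directions, ← Multiset.coe_add, Multiset.coe_replicate]
  congr 1
  rw [← List.sum_ofFn, List.ofFn_eq_map]
  induction List.finRange d with
  | nil => rfl
  | cons ℓ L ih =>
    rw [List.flatMap_cons, ← Multiset.coe_add, ih, Multiset.coe_replicate, List.map_cons,
      List.sum_cons]

theorem directions_add_single_perm (j : Option (Fin d) → ℕ) (k : Option (Fin d)) :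
    (directions (j + Pi.single k 1)).Perm (directions j ++ [spaceTimeBasis d k]) := by
  rw [← Multiset.coe_eq_coe, ← Multiset.coe_add, coe_directions, coe_directions]
  simp only [Pi.add_apply, Multiset.replicate_add, Finset.sum_add_distrib]
  congr 1
  rw [Finset.sum_eq_single k (fun i _ hi => by simp [hi]) (by simp)]
  simp

theorem Dm_eq_iterDirDeriv (j : Option (Fin d) → ℕ) (f : (Fin d → ℝ) × ℝ → ℂ) :
    Dm d (fun ℓ => j (some ℓ)) (j none) f = iterDirDeriv (directions j) f := by
  have hpT : pT d = dirDeriv (spaceTimeBasis d none) := rfl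
  have hpS : ∀ ℓ, pS d ℓ = dirDeriv (spaceTimeBasis d (some ℓ)) := fun _ => rfl
  rw [Dm, directions, iterDirDeriv_append, hpT, iterate_dirDeriv]
  congr 1
  induction List.finRange d with
  | nil => rfl
  | cons ℓ L ih =>
    rw [List.foldr_cons, Function.comp_apply, ih, hpS, iterate_dirDeriv, List.flatMap_cons,
      iterDirDeriv_append]

theorem extTaylor_eq_weightedPoly (p : ℕ) (ψ : (Fin d → ℝ) × ℝ → ℂ) (z : Fin d → ℝ) (s : ℝ) :
    extTaylor d p ψ z s = weightedPoly (parabolicWeight d) (spaceTimeCoord d) (z, s)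
      (fun j => iterDirDeriv (directions j) ψ (z, s)) (2 * p + 1) := by
  funext y
  rw [extTaylor, ← Finset.sum_product', ← Finset.sum_filter, weightedPoly]
  symm
  refine Finset.sum_bij' (fun j _ => (j none, fun ℓ => j (some ℓ)))
    (fun q _ o => o.elim q.1 q.2) ?_ ?_ ?_ ?_ ?_
  · intro j hj
    rw [mem_weightedIndices one_le_parabolicWeight, sum_parabolicWeight] at hj
    simp only [Finset.mem_filter, Finset.mem_product, Finset.mem_range, Fintype.mem_piFinset]
    refine ⟨⟨by omega, fun ℓ => ?_⟩, by omega⟩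
    have := Finset.single_le_sum (f := fun ℓ => j (some ℓ)) (fun _ _ => Nat.zero_le _)
      (Finset.mem_univ ℓ)
    omega
  · intro q hq
    rw [mem_weightedIndices one_le_parabolicWeight, sum_parabolicWeight]
    have := (Finset.mem_filter.1 hq).2
    simp only [Option.elim]
    omega
  · intro j _
    funext o
    cases o <;> rfl
  · intro q _
    rfl
  · intro j _
    rw [Dm_eq_iterDirDeriv, divMonomial, Fintype.prod_option]
    simp only [divPow, spaceTimeCoord, Option.elim, Finset.prod_div_distrib,
      ContinuousLinearMap.coe_snd', ContinuousLinearMap.comp_apply, ContinuousLinearMap.coe_fst',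
      ContinuousLinearMap.proj_apply, Prod.fst_sub, Prod.snd_sub, Pi.sub_apply]
    push_cast
    rw [mul_inv]
    ring

theorem exists_polynomial_eq_weightedPoly (c : (Fin d → ℝ) × ℝ)
    (a : (Option (Fin d) → ℕ) → ℂ) (n : ℕ) :
    ∃ Q : MvPolynomial (Option (Fin d)) ℂ, Q.totalDegree ≤ n ∧
      ∀ y : (Fin d → ℝ) × ℝ,
        MvPolynomial.eval (fun v => v.elim ((y.2 : ℝ) : ℂ) (fun ℓ => ((y.1 ℓ : ℝ) : ℂ))) Q
          = weightedPoly (parabolicWeight d) (spaceTimeCoord d) c a (n + 1) y := by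
  refine ⟨∑ j ∈ weightedIndices (parabolicWeight d) (n + 1), MvPolynomial.C (a j) *
    ∏ o, (MvPolynomial.X o - MvPolynomial.C ((spaceTimeCoord d o c : ℝ) : ℂ)) ^ j o *
      MvPolynomial.C (((j o).factorial : ℂ)⁻¹), ?_, fun y => ?_⟩
  · refine MvPolynomial.totalDegree_finsetSum_le fun j hj => ?_
    rw [mem_weightedIndices one_le_parabolicWeight] at hj
    refine (MvPolynomial.totalDegree_mul _ _).trans ?_
    rw [MvPolynomial.totalDegree_C, zero_add]
    refine (MvPolynomial.totalDegree_finsetProd _ _).trans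
      (le_trans (Finset.sum_le_sum fun o _ => ?_) (Nat.lt_succ_iff.1 hj))
    refine (MvPolynomial.totalDegree_mul _ _).trans ?_
    rw [MvPolynomial.totalDegree_C, add_zero]
    refine (MvPolynomial.totalDegree_pow _ _).trans ?_
    rw [mul_comm]
    gcongr
    exact ((MvPolynomial.totalDegree_sub_C_le _ _).trans
      (MvPolynomial.totalDegree_X o).le).trans (one_le_parabolicWeight o)
  · rw [map_sum, weightedPoly]
    refine Finset.sum_congr rfl fun j _ => ?_
    rw [map_mul, MvPolynomial.eval_C, map_prod, divMonomial]
    congr 1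
    refine Finset.prod_congr rfl fun o _ => ?_
    cases o <;> simp [divPow, spaceTimeCoord, div_eq_mul_inv]

/-- The Taylor coefficients of a Trefftz function satisfy the Schrödinger recurrence. -/
theorem iterDirDeriv_directions_recurrence {Ω : Set ((Fin d → ℝ) × ℝ)} (hΩ : IsOpen Ω)
    {ψ : (Fin d → ℝ) × ℝ → ℂ} (hψ : ContDiffOn ℝ (⊤ : ℕ∞) ψ Ω)
    (htrefftz : ∀ y ∈ Ω, Complex.I * pT d ψ y + (1/2 : ℂ) * ∑ ℓ, pS d ℓ (pS d ℓ ψ) y = 0)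
    {c : (Fin d → ℝ) × ℝ} (hc : c ∈ Ω) (j : Option (Fin d) → ℕ) :
    Complex.I * iterDirDeriv (directions (j + Pi.single none 1)) ψ c + (1/2 : ℂ) * ∑ ℓ : Fin d,
      iterDirDeriv (directions (j + Pi.single (some ℓ) 1 + Pi.single (some ℓ) 1)) ψ c = 0 := by
  have hT : iterDirDeriv (directions (j + Pi.single none 1)) ψ c =
      iterDirDeriv (directions j) (pT d ψ) c := by
    rw [iterDirDeriv_perm hΩ hψ (directions_add_single_perm j none) hc, iterDirDeriv_append]
    rfl
  have hS : ∀ ℓ : Fin d,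
      iterDirDeriv (directions (j + Pi.single (some ℓ) 1 + Pi.single (some ℓ) 1)) ψ c =
        iterDirDeriv (directions j) (pS d ℓ (pS d ℓ ψ)) c := fun ℓ => by
    rw [iterDirDeriv_perm hΩ hψ ((directions_add_single_perm _ (some ℓ)).trans
      ((directions_add_single_perm j (some ℓ)).append_right _)) hc, iterDirDeriv_append,
      iterDirDeriv_append]
    rfl
  simp only [hT, hS]
  have hlin := iterDirDeriv_sum hΩ Finset.univ
    (fun o : Option (Fin d) => o.elim Complex.I fun _ => 1/2)
    (fun o => o.elim (pT d ψ) fun ℓ => pS d ℓ (pS d ℓ ψ))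
    (by
      rintro (_ | ℓ) -
      · exact hψ.dirDeriv hΩ _
      · exact (hψ.dirDeriv hΩ _).dirDeriv hΩ _) (directions j) hc
  have hzero := iterDirDeriv_sum hΩ (∅ : Finset Empty) (fun _ => 0) (fun _ _ => 0) (by simp)
    (directions j) hc
  simp only [Fintype.sum_option, Option.elim, ← Finset.mul_sum] at hlin
  rw [← hlin]
  exact (Set.EqOn.iterDirDeriv hΩ (g := fun _ => 0) (fun y hy => htrefftz y hy) _ hc).trans
    (by simpa using hzero)

end Schrodinger

/-- If `ψ` is smooth and Trefftz (`i ∂_t ψ + (1/2) Δ_x ψ = 0`) on an open set `Ω ∋ (z,s)`, then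
its extended Taylor polynomial of degree `2p` centered at `(z,s)` is a polynomial in `(x,t)` of
total degree at most `2p` and is Trefftz on all of `ℝ^d × ℝ`. -/
theorem extTaylor_is_trefftz_polynomial (d p : ℕ) (hd : 1 ≤ d)
    (Ω : Set ((Fin d → ℝ) × ℝ)) (hΩ : IsOpen Ω) (z : Fin d → ℝ) (s : ℝ) (hzs : (z, s) ∈ Ω)
    (ψ : (Fin d → ℝ) × ℝ → ℂ) (hsmooth : ContDiffOn ℝ (⊤ : ℕ∞) ψ Ω)
    (htrefftz : ∀ y ∈ Ω, Complex.I * pT d ψ y + (1/2 : ℂ) * ∑ ℓ, pS d ℓ (pS d ℓ ψ) y = 0) :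
    (∃ Q : MvPolynomial (Option (Fin d)) ℂ, Q.totalDegree ≤ 2 * p ∧
      ∀ y : (Fin d → ℝ) × ℝ,
        MvPolynomial.eval (fun v => v.elim ((y.2 : ℝ) : ℂ) (fun ℓ => ((y.1 ℓ : ℝ) : ℂ))) Q
          = extTaylor d p ψ z s y) ∧
    ∀ y : (Fin d → ℝ) × ℝ, Complex.I * pT d (extTaylor d p ψ z s) y
      + (1/2 : ℂ) * ∑ ℓ, pS d ℓ (pS d ℓ (extTaylor d p ψ z s)) y = 0 := by
  rw [extTaylor_eq_weightedPoly]
  refine ⟨exists_polynomial_eq_weightedPoly _ _ _, fun y => ?_⟩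
  have hderiv := fun a n k => dirDeriv_weightedPoly (spaceTimeCoord_basis (d := d))
    one_le_parabolicWeight (z, s) a n k
  have hpT : pT d = dirDeriv (spaceTimeBasis d none) := rfl
  have hpS : ∀ ℓ, pS d ℓ = dirDeriv (spaceTimeBasis d (some ℓ)) := fun _ => rfl
  have hwT : ∀ n, n - parabolicWeight d none = n - 2 := fun _ => rfl
  have hwS : ∀ n (ℓ : Fin d),
      n - parabolicWeight d (some ℓ) - parabolicWeight d (some ℓ) = n - 2 := fun _ _ => rfl
  simp only [hpT, hpS, hderiv, hwT, hwS, weightedPoly]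
  rw [Finset.sum_comm, Finset.mul_sum, Finset.mul_sum, ← Finset.sum_add_distrib]
  refine Finset.sum_eq_zero fun j _ => ?_
  rw [← Finset.sum_mul, ← mul_assoc, ← mul_assoc, ← add_mul,
    iterDirDeriv_directions_recurrence hΩ hsmooth htrefftz hzs, zero_mul]
end
end

section
/- Let d ≥ 1, t_0 ∈ ℝ, and let q ∈ ℂ[x_1, …, x_d, t] satisfy i ∂_t q + (1/2) Δ_x q = 0 identically. If q(x, t_0) = 0 for all x ∈ ℝ^d, then q is the zero polynomial. Consequently, every polynomial Trefftz function is uniquely determined by its restriction to any time slice {t = t_0}. -/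
noncomputable section

open MvPolynomial

namespace MvPolynomial

variable {R σ : Type*} [CommSemiring R]

theorem pderiv_comm (i j : σ) (p : MvPolynomial σ R) :
    pderiv i (pderiv j p) = pderiv j (pderiv i p) := by
  classical
  ext m
  by_cases h : i = j
  · rw [h]
  · simp only [coeff_pderiv, Finsupp.add_apply, Finsupp.single_eq_of_ne h,
      Finsupp.single_eq_of_ne (Ne.symm h), add_zero,
      add_right_comm m (Finsupp.single i 1)]
    exact mul_right_comm _ _ _

theorem optionEquivLeft_pderiv_none (p : MvPolynomial (Option σ) R) :
    optionEquivLeft R σ (pderiv none p) = (optionEquivLeft R σ p).derivative := by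
  induction p using MvPolynomial.induction_on with
  | C a => simp
  | add p q hp hq => simp [hp, hq]
  | mul_X p v hp => cases v <;> simp [hp, mul_comm]

/-- The restriction of a polynomial in the variables `some ℓ` and `none` to the slice on which
the variable `none` takes the value `c`. -/
def slice (c : R) : MvPolynomial (Option σ) R →ₐ[R] MvPolynomial σ R :=
  aeval fun v => v.elim (C c) X

theorem slice_eq_eval_optionEquivLeft (c : R) (p : MvPolynomial (Option σ) R) :
    slice c p = (optionEquivLeft R σ p).eval (C c) := by
  induction p using MvPolynomial.induction_on with
  | C a => simp [slice]
  | add p q hp hq => simp [hp, hq]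
  | mul_X p v hp => cases v <;> simp [slice] <;> simp [← hp, slice]

theorem eval_slice (c : R) (x : σ → R) (p : MvPolynomial (Option σ) R) :
    eval x (slice c p) = eval (fun v => v.elim c x) p := by
  induction p using MvPolynomial.induction_on with
  | C a => simp [slice]
  | add p q hp hq => simp [hp, hq]
  | mul_X p v hp => cases v <;> simp [← hp, slice]

theorem slice_pderiv_some (c : R) (i : σ) (p : MvPolynomial (Option σ) R) :
    slice c (pderiv (some i) p) = pderiv i (slice c p) := by
  classical
  induction p using MvPolynomial.induction_on with
  | C a => simp [slice]
  | add p q hp hq => simp [hp, hq]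
  | mul_X p v hp =>
    cases v <;>
      simp only [Derivation.leibniz, pderiv_X, smul_eq_mul, map_add, map_mul, hp] <;>
      simp [slice, Pi.single_apply, apply_ite]

/-- In characteristic zero, a polynomial all of whose iterated derivatives in the variable `none`
vanish on a slice is zero. -/
theorem eq_zero_of_forall_slice_iterate_pderiv {K : Type*} [Field K] [CharZero K] (c : K)
    (p : MvPolynomial (Option σ) K) (h : ∀ n, slice c ((pderiv none)^[n] p) = 0) : p = 0 := by
  have key : ∀ n, optionEquivLeft K σ ((pderiv none)^[n] p) =
      Polynomial.derivative^[n] (optionEquivLeft K σ p) :=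
    fun n => Function.Semiconj.iterate_right optionEquivLeft_pderiv_none n p
  by_contra hp
  have hP : optionEquivLeft K σ p ≠ 0 := by simpa using hp
  refine lt_irrefl _ ((Polynomial.lt_rootMultiplicity_iff_isRoot_iterate_derivative
    (t := C c) (n := (optionEquivLeft K σ p).rootMultiplicity (C c)) hP).2 fun m _ => ?_)
  rw [Polynomial.IsRoot, ← key, ← slice_eq_eval_optionEquivLeft, h]

/-- A complex polynomial that vanishes at all real points is zero. -/
theorem eq_zero_of_forall_eval_ofReal (p : MvPolynomial σ ℂ)
    (h : ∀ x : σ → ℝ, eval (fun i => (x i : ℂ)) p = 0) : p = 0 := by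
  refine funext_set (fun _ => Set.range ((↑) : ℝ → ℂ))
    (fun _ => Set.infinite_range_of_injective Complex.ofReal_injective) fun x hx => ?_
  choose y hy using fun i => hx i (Set.mem_univ i)
  rw [map_zero, ← h y]
  simp only [hy]

end MvPolynomial

/-- The Schrödinger operator `i ∂_t + (1/2) Δ_x`. -/
def schrodinger (d : ℕ) : MvPolynomial (Option (Fin d)) ℂ → MvPolynomial (Option (Fin d)) ℂ :=
  fun q => Complex.I • pderiv (none : Option (Fin d)) q
    + (1/2 : ℂ) • ∑ ℓ : Fin d, pderiv (some ℓ) (pderiv (some ℓ) q)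

theorem schrodinger_pderiv {d : ℕ} (i : Option (Fin d)) (q : MvPolynomial (Option (Fin d)) ℂ) :
    schrodinger d (pderiv i q) = pderiv i (schrodinger d q) := by
  simp only [schrodinger, map_add, Derivation.map_smul, map_sum, pderiv_comm i]

/-- The time derivative of a Trefftz polynomial vanishes on every time slice on which the
polynomial itself does. -/
theorem slice_pderiv_none_eq_zero {d : ℕ} {c : ℂ} {q : MvPolynomial (Option (Fin d)) ℂ}
    (hq : schrodinger d q = 0) (hc : slice c q = 0) : slice c (pderiv none q) = 0 := by
  have h := congrArg (slice c) hq
  simp only [schrodinger, map_add, map_smul, map_sum, slice_pderiv_some, hc, map_zero,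
    Finset.sum_const_zero, smul_zero, add_zero] at h
  exact (smul_eq_zero.1 h).resolve_left Complex.I_ne_zero

/-- A polynomial Trefftz function (`i ∂_t q + (1/2) Δ_x q = 0`, with variable `some ℓ` being
`x_ℓ` and variable `none` being `t`) that vanishes on the time slice `{t = t_0}` is the zero
polynomial; hence a polynomial Trefftz function is uniquely determined by its restriction to
any time slice. -/
theorem trefftz_determined_by_time_slice (d : ℕ) (hd : 1 ≤ d) (t₀ : ℝ)
    (q : MvPolynomial (Option (Fin d)) ℂ)
    (htrefftz : Complex.I • pderiv (none : Option (Fin d)) q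
        + (1/2 : ℂ) • ∑ ℓ : Fin d, pderiv (some ℓ) (pderiv (some ℓ) q) = 0)
    (hslice : ∀ x : Fin d → ℝ,
      MvPolynomial.eval (fun v => v.elim ((t₀ : ℝ) : ℂ) (fun ℓ => ((x ℓ : ℝ) : ℂ))) q = 0) :
    q = 0 := by
  have hq : schrodinger d q = 0 := htrefftz
  have hc : slice (t₀ : ℂ) q = 0 :=
    eq_zero_of_forall_eval_ofReal _ fun x => (eval_slice _ _ q).trans (hslice x)
  have key : ∀ n, schrodinger d ((pderiv none)^[n] q) = 0 ∧
      slice (t₀ : ℂ) ((pderiv none)^[n] q) = 0 := by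
    intro n
    induction n with
    | zero => exact ⟨hq, hc⟩
    | succ n ih =>
      rw [Function.iterate_succ_apply']
      exact ⟨by rw [schrodinger_pderiv, ih.1, map_zero], slice_pderiv_none_eq_zero ih.1 ih.2⟩
  exact eq_zero_of_forall_slice_iterate_pderiv _ q fun n => (key n).2
end
end

section
/- For a natural number p, the binomial coefficient C(2p + 3, 3) is strictly less than C(p + 4, 4) if and only if p ≥ 25. Equivalently, in space dimension d = 3, the dimension of the Trefftz polynomial space of degree 2p is strictly smaller than the dimension of the full polynomial space of degree p in 4 variables exactly when p > 24. -/
theorem Nat.six_mul_choose_add_three_three (n : ℕ) :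
    6 * (n + 3).choose 3 = (n + 3) * (n + 2) * (n + 1) := by
  have h := Nat.ascFactorial_eq_factorial_mul_choose n 3
  simp only [Nat.ascFactorial_succ, Nat.ascFactorial_zero, Nat.factorial] at h
  linarith

theorem Nat.twentyFour_mul_choose_add_four_four (n : ℕ) :
    24 * (n + 4).choose 4 = (n + 4) * (n + 3) * (n + 2) * (n + 1) := by
  have h := Nat.ascFactorial_eq_factorial_mul_choose n 4
  simp only [Nat.ascFactorial_succ, Nat.ascFactorial_zero, Nat.factorial] at h
  linarith

/-- In space dimension `d = 3`, the dimension `C(2p+3, 3)` of the Trefftz polynomial space of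
degree `2p` is strictly smaller than the dimension `C(p+4, 4)` of the full polynomial space of
degree `p` in `4` variables exactly when `p ≥ 25`. -/
theorem trefftz_dim_lt_full_dim_d3 (p : ℕ) :
    Nat.choose (2 * p + 3) 3 < Nat.choose (p + 4) 4 ↔ 25 ≤ p := by
  have h3 := Nat.six_mul_choose_add_three_three (2 * p)
  have h4 := Nat.twentyFour_mul_choose_add_four_four p
  constructor
  · intro h
    by_contra! hp
    interval_cases p <;> omega
  · intro hp
    obtain ⟨k, rfl⟩ := Nat.exists_eq_add_of_le hp
    ring_nf at h3 h4 ⊢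
    nlinarith [Nat.zero_le (k ^ 2), Nat.zero_le (k ^ 3), Nat.zero_le (k ^ 4)]
end
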